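/- Let k = k(r) ≥ 2 and n = n(r) = k(r)·r be sequences with λ = k − 1 and k = o(n^{1−α}) for some fixed 0 < α < 1, and let σ_n = (1/√3)·log^{3/2}(√(n/λ)). Then there is a constant κ > 0 such that for every ε > 0 and all sufficiently large r, the uniform probability over {0,k}-mappings f on [n] that (log B(f) − log T(f))/σ_n > ε is at most κ·(log log n)²·(log n)/(ε·σ_n). In particular, for each fixed ε > 0 this probability tends to 0 as r → ∞. -/

import Mathlib

open Filter Finset Asymptotics MeasureTheory

noncomputable section

open scoped Classical

/-- `f` is a `{0,k}`-mapping: every point has either `0` or `k` preimages. -/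
def IsZKMap {n : ℕ} (k : ℕ) (f : Fin n → Fin n) : Prop :=
  ∀ y : Fin n,
    (Finset.univ.filter fun x => f x = y).card = 0 ∨
    (Finset.univ.filter fun x => f x = y).card = k

/-- The finite set of `{0,k}`-mappings on `[n]`. -/
def zkMaps (n k : ℕ) : Finset (Fin n → Fin n) :=
  Finset.univ.filter fun f => IsZKMap k f

/-- The set of cyclic nodes of `f`. -/
def cyclicSet {n : ℕ} (f : Fin n → Fin n) : Finset (Fin n) :=
  Finset.univ.filter fun x => ∃ m, 0 < m ∧ f^[m] x = x

/-- `Z f`: the number of cyclic nodes of `f`. -/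
def Zmap {n : ℕ} (f : Fin n → Fin n) : ℕ := (cyclicSet f).card

/-- The cycles of `f`: the orbits of the cyclic nodes under `f`. -/
def cyclesOf {n : ℕ} (f : Fin n → Fin n) : Finset (Finset (Fin n)) :=
  (cyclicSet f).image fun x => (cyclicSet f).filter fun y => ∃ m, f^[m] x = y

/-- `T f`: the least common multiple of the cycle lengths of `f`. -/
def Tmap {n : ℕ} (f : Fin n → Fin n) : ℕ := (cyclesOf f).lcm Finset.card

/-- `B f`: the product of the cycle lengths of `f`, counted with multiplicity. -/
def Bmap {n : ℕ} (f : Fin n → Fin n) : ℕ := ∏ c ∈ cyclesOf f, c.card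

/-- `C f`: the number of cycles of `f`. -/
def Cmap {n : ℕ} (f : Fin n → Fin n) : ℕ := (cyclesOf f).card

/-- Uniform probability of the event `p` over `{0,k}`-mappings on `[n]`. -/
def zkProb (n k : ℕ) (p : (Fin n → Fin n) → Prop) : ℝ :=
  (((zkMaps n k).filter p).card : ℝ) / ((zkMaps n k).card : ℝ)

/-- Expectation of `X` under the uniform measure on `{0,k}`-mappings on `[n]`. -/
def zkExp (n k : ℕ) (X : (Fin n → Fin n) → ℝ) : ℝ :=
  (∑ f ∈ zkMaps n k, X f) / ((zkMaps n k).card : ℝ)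

/-- The standard normal cumulative distribution function. -/
def stdNormalCDF (x : ℝ) : ℝ :=
  (Real.sqrt (2 * Real.pi))⁻¹ * ∫ t in Set.Iic x, Real.exp (-t ^ 2 / 2)

/-- `M m`: the average order of a uniformly random permutation of `[m]`. -/
def Mperm (m : ℕ) : ℝ :=
  (∑ σ : Equiv.Perm (Fin m), (orderOf σ : ℝ)) / (m.factorial : ℝ)

open Equiv Equiv.Perm in
lemma sum_sum_cycleFactorsFinset {β : Type*} [Fintype β] [DecidableEq β]
    (φ : ℕ → Multiset ℕ → ℝ) :
    ∑ σ : Perm β, ∑ c ∈ σ.cycleFactorsFinset,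
        φ c.support.card (σ.cycleType - {c.support.card}) =
      ∑ c : Perm β with c.IsCycle, ∑ τ : Perm {x // x ∉ c.support},
        φ c.support.card τ.cycleType := by
  rw [Finset.sum_comm' (t' := Finset.univ.filter fun c : Perm β => c.IsCycle)
    (s' := fun c => Finset.univ.filter fun σ : Perm β => c ∈ σ.cycleFactorsFinset)]
  · refine Finset.sum_congr rfl fun c hc => ?_
    have hc : c.IsCycle := by simpa using hc
    have hdisj : ∀ τ : Perm {x // x ∉ c.support}, (ofSubtype τ).Disjoint c := by
      intro τ x
      by_cases hx : x ∈ c.support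
      · exact Or.inl (ofSubtype_apply_of_not_mem τ (by simpa using hx))
      · exact Or.inr (by simpa using hx)
    symm
    refine Finset.sum_bij (fun τ _ => ofSubtype τ * c) ?_ ?_ ?_ ?_
    · intro τ _
      simp only [Finset.mem_filter, Finset.mem_univ, true_and]
      rw [(hdisj τ).cycleFactorsFinset_mul_eq_union, hc.cycleFactorsFinset_eq_singleton]
      simp
    · intro τ _ τ' _ h
      exact ofSubtype_injective (mul_right_cancel h)
    · intro σ hσ
      have hσ : c ∈ σ.cycleFactorsFinset := by simpa using hσ
      have hd := disjoint_mul_inv_of_mem_cycleFactorsFinset hσ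
      have hfix : ∀ x, (σ * c⁻¹) x ≠ x → x ∉ c.support := fun x hx => by
        simpa using (hd x).resolve_left hx
      refine ⟨subtypePerm (σ * c⁻¹) (p := fun x => x ∉ c.support) ?_, Finset.mem_univ _, ?_⟩
      · intro x
        by_cases hx : (σ * c⁻¹) x = x
        · rw [hx]
        · exact iff_of_true (hfix _ fun h => hx ((σ * c⁻¹).injective h)) (hfix x hx)
      · rw [ofSubtype_subtypePerm _ hfix]
        simp
    · intro τ _
      rw [(hdisj τ).cycleType_mul, hc.cycleType, cycleType_ofSubtype]
      simp
  · intro σ c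
    simp only [Finset.mem_univ, true_and, Finset.mem_filter]
    exact ⟨fun h => ⟨h, (mem_cycleFactorsFinset_iff.1 h).1⟩, fun h => h.1⟩

open Equiv Equiv.Perm in
lemma sum_isCycle_le {β : Type*} [Fintype β] [DecidableEq β] (φ : ℕ → Multiset ℕ → ℝ)
    (w : ℕ → ℝ)
    (h : ∀ c : Perm β, c.IsCycle → ∑ τ : Perm {x // x ∉ c.support}, φ c.support.card τ.cycleType ≤
      (Fintype.card β - c.support.card).factorial * w c.support.card) :
    ∑ c : Perm β with c.IsCycle, ∑ τ : Perm {x // x ∉ c.support},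
        φ c.support.card τ.cycleType ≤
      (Fintype.card β).factorial * ∑ i ∈ Finset.Icc 2 (Fintype.card β), w i / i := by
  calc _ ≤ ∑ c : Perm β with c.IsCycle,
        ((Fintype.card β - c.support.card).factorial : ℝ) * w c.support.card :=
        Finset.sum_le_sum fun c hc => h c (by simpa using hc)
    _ = ∑ i ∈ Finset.Icc 2 (Fintype.card β), ∑ c : Perm β with c.IsCycle ∧ c.support.card = i,
          ((Fintype.card β - c.support.card).factorial : ℝ) * w c.support.card := by
        rw [← Finset.sum_fiberwise_of_maps_to (g := fun c : Perm β => c.support.card)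
          (t := Finset.Icc 2 (Fintype.card β))]
        · simp only [Finset.filter_filter]
        · intro c hc
          have hc : c.IsCycle := by simpa using hc
          exact Finset.mem_Icc.2 ⟨hc.two_le_card_support, Finset.card_le_univ _⟩
    _ = ∑ i ∈ Finset.Icc 2 (Fintype.card β),
          (Finset.univ.filter fun c : Perm β => c.cycleType = {i}).card *
            (((Fintype.card β - i).factorial : ℝ) * w i) := by
        refine Finset.sum_congr rfl fun i _ => ?_
        rw [← nsmul_eq_mul, ← Finset.sum_const]
        have : (Finset.univ.filter fun c : Perm β => c.IsCycle ∧ c.support.card = i) =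
            Finset.univ.filter fun c : Perm β => c.cycleType = {i} := by
          ext c
          simp only [Finset.mem_filter, Finset.mem_univ, true_and]
          constructor
          · rintro ⟨hc, rfl⟩
            exact hc.cycleType
          · intro hc
            have hcy : c.IsCycle := by rw [← card_cycleType_eq_one, hc, Multiset.card_singleton]
            refine ⟨hcy, ?_⟩
            rw [hcy.cycleType] at hc
            exact Multiset.singleton_inj.1 hc
        rw [this]
        refine Finset.sum_congr rfl fun c hc => ?_
        have hc : c.cycleType = {i} := by simpa using hc
        have : c.support.card = i := by rw [← sum_cycleType, hc, Multiset.sum_singleton]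
        rw [this]
    _ = _ := by
        rw [Finset.mul_sum]
        refine Finset.sum_congr rfl fun i hi => ?_
        obtain ⟨h2, hi⟩ := Finset.mem_Icc.1 hi
        rw [card_of_cycleType_singleton h2 hi]
        have hi0 : (i : ℝ) ≠ 0 := by positivity
        have e1 : ((Fintype.card β).choose i * i.factorial * (Fintype.card β - i).factorial : ℝ) =
            (Fintype.card β).factorial := by
          exact_mod_cast Nat.choose_mul_factorial_mul_factorial hi
        have e2 : (i : ℝ) * (i - 1).factorial = i.factorial := by
          exact_mod_cast Nat.mul_factorial_pred (by lia)
        rw [← e1, ← e2]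
        push_cast
        field_simp

/-- The number of parts of `s` divisible by `d`. -/
def dvdCount (d : ℕ) (s : Multiset ℕ) : ℕ := s.countP (d ∣ ·)

/-- The sum of the reciprocals of the multiples of `d` in `[1, n]`. -/
def dvdHarmonic (d n : ℕ) : ℝ := ∑ i ∈ Finset.Icc 1 n, if d ∣ i then (1 / i : ℝ) else 0

lemma dvdHarmonic_mono (d : ℕ) : Monotone (dvdHarmonic d) := fun a b h =>
  Finset.sum_le_sum_of_subset_of_nonneg (Finset.Icc_subset_Icc_right h)
    fun i _ _ => by positivity

lemma dvdHarmonic_nonneg (d n : ℕ) : 0 ≤ dvdHarmonic d n :=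
  Finset.sum_nonneg fun i _ => by positivity

lemma sum_Icc_two_le_dvdHarmonic (d n : ℕ) :
    ∑ i ∈ Finset.Icc 2 n, (if d ∣ i then (1 : ℝ) else 0) / i ≤ dvdHarmonic d n := by
  unfold dvdHarmonic
  refine (Finset.sum_le_sum_of_subset_of_nonneg (Finset.Icc_subset_Icc_left one_le_two)
    fun i _ _ => by positivity).trans (Finset.sum_le_sum fun i _ => ?_)
  split_ifs <;> simp

lemma dvdHarmonic_le {d : ℕ} (hd : 0 < d) (n : ℕ) :
    dvdHarmonic d n ≤ (1 + Real.log n) / d := by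
  have h : dvdHarmonic d n ≤ ∑ j ∈ Finset.Icc 1 n, (1 / (d * j : ℝ)) := by
    unfold dvdHarmonic
    rw [← Finset.sum_filter]
    calc _ ≤ ∑ i ∈ (Finset.Icc 1 n).image (d * ·), (1 / i : ℝ) := by
          refine Finset.sum_le_sum_of_subset_of_nonneg ?_ fun i _ _ => by positivity
          intro i hi
          obtain ⟨hi, j, rfl⟩ := Finset.mem_filter.1 hi
          obtain ⟨h1, h2⟩ := Finset.mem_Icc.1 hi
          refine Finset.mem_image.2 ⟨j, Finset.mem_Icc.2 ⟨?_, ?_⟩, rfl⟩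
          · exact Nat.pos_of_mul_pos_left h1
          · exact (Nat.le_mul_of_pos_left j hd).trans h2
      _ = _ := by
          rw [Finset.sum_image fun a _ b _ h => Nat.eq_of_mul_eq_mul_left hd h]
          simp
  refine h.trans ?_
  have h2 : ∑ j ∈ Finset.Icc 1 n, (1 / (d * j : ℝ)) = (harmonic n : ℝ) / d := by
    rw [harmonic_eq_sum_Icc, Rat.cast_sum, Finset.sum_div]
    refine Finset.sum_congr rfl fun j _ => ?_
    push_cast
    field_simp
  rw [h2]
  have := harmonic_le_one_add_log n
  gcongr

open Equiv Equiv.Perm in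
lemma dvdCount_cycleType {β : Type*} [Fintype β] [DecidableEq β] (d : ℕ) (σ : Perm β) :
    dvdCount d σ.cycleType =
      (σ.cycleFactorsFinset.filter fun c => d ∣ c.support.card).card := by
  rw [dvdCount, cycleType_def, Multiset.countP_map]
  rfl

open Equiv Equiv.Perm in
lemma sum_dvdCount_le {β : Type*} [Fintype β] [DecidableEq β] (d : ℕ) :
    ∑ σ : Perm β, (dvdCount d σ.cycleType : ℝ) ≤
      (Fintype.card β).factorial * dvdHarmonic d (Fintype.card β) := by
  have h := sum_sum_cycleFactorsFinset (β := β) fun i _ => if d ∣ i then (1 : ℝ) else 0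
  have h' : ∑ σ : Perm β, (dvdCount d σ.cycleType : ℝ) =
      ∑ σ : Perm β, ∑ c ∈ σ.cycleFactorsFinset, if d ∣ c.support.card then (1 : ℝ) else 0 := by
    refine Finset.sum_congr rfl fun σ _ => ?_
    rw [dvdCount_cycleType, Finset.sum_boole]
  rw [h']
  refine h.trans_le ((sum_isCycle_le (fun i _ => if d ∣ i then (1 : ℝ) else 0)
    (fun i => if d ∣ i then (1 : ℝ) else 0) fun c _ => ?_).trans ?_)
  · have hcard : Fintype.card {x // x ∉ c.support} = Fintype.card β - c.support.card := by
      rw [Fintype.card_subtype_compl, Fintype.card_coe]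
    rw [Finset.sum_const, Finset.card_univ, Fintype.card_perm, hcard, nsmul_eq_mul]
  · gcongr
    exact sum_Icc_two_le_dvdHarmonic d _

open Equiv Equiv.Perm in
lemma sum_dvdCount_mul_le {β : Type*} [Fintype β] [DecidableEq β] (d : ℕ) :
    ∑ σ : Perm β, (dvdCount d σ.cycleType : ℝ) * ((dvdCount d σ.cycleType : ℝ) - 1) ≤
      (Fintype.card β).factorial * dvdHarmonic d (Fintype.card β) ^ 2 := by
  have h := sum_sum_cycleFactorsFinset (β := β)
    fun i s => if d ∣ i then (dvdCount d s : ℝ) else 0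
  have h' : ∑ σ : Perm β, (dvdCount d σ.cycleType : ℝ) * ((dvdCount d σ.cycleType : ℝ) - 1) =
      ∑ σ : Perm β, ∑ c ∈ σ.cycleFactorsFinset, if d ∣ c.support.card then
        (dvdCount d (σ.cycleType - {c.support.card}) : ℝ) else 0 := by
    refine Finset.sum_congr rfl fun σ _ => ?_
    rw [← Finset.sum_filter]
    have : ∀ c ∈ σ.cycleFactorsFinset.filter fun c => d ∣ c.support.card,
        (dvdCount d (σ.cycleType - {c.support.card}) : ℝ) =
          (dvdCount d σ.cycleType : ℝ) - 1 := by
      intro c hc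
      obtain ⟨hc, hd⟩ := Finset.mem_filter.1 hc
      have hmem : {c.support.card} ≤ σ.cycleType := by
        rw [Multiset.singleton_le, cycleType_def]
        exact Multiset.mem_map.2 ⟨c, hc, rfl⟩
      have hle := Multiset.countP_le_of_le (d ∣ ·) hmem
      rw [dvdCount, dvdCount, Multiset.countP_sub hmem, Nat.cast_sub hle]
      simp [← Multiset.cons_zero, Multiset.countP_cons_of_pos, hd]
    rw [Finset.sum_congr rfl this, Finset.sum_const, nsmul_eq_mul, dvdCount_cycleType]
  rw [h']
  refine h.trans_le ((sum_isCycle_le (fun i s => if d ∣ i then (dvdCount d s : ℝ) else 0)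
    (fun i => (if d ∣ i then (1 : ℝ) else 0) *
    dvdHarmonic d (Fintype.card β)) fun c _ => ?_).trans ?_)
  · split_ifs with hd
    · have := sum_dvdCount_le (β := {x // x ∉ c.support}) d
      have hcard : Fintype.card {x // x ∉ c.support} = Fintype.card β - c.support.card := by
        rw [Fintype.card_subtype_compl, Fintype.card_coe]
      rw [hcard] at this
      refine this.trans ?_
      rw [one_mul]
      gcongr
      exact dvdHarmonic_mono d (Nat.sub_le _ _)
    · simp
  · simp_rw [mul_div_right_comm, ← Finset.sum_mul, sq]
    gcongr
    · exact dvdHarmonic_nonneg _ _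
    · exact sum_Icc_two_le_dvdHarmonic d _

open Equiv Equiv.Perm in
lemma sum_dvdCount_sub_one_le {β : Type*} [Fintype β] [DecidableEq β] (d : ℕ) :
    ∑ σ : Perm β, ((dvdCount d σ.cycleType - 1 : ℕ) : ℝ) ≤ (Fintype.card β).factorial *
      min (dvdHarmonic d (Fintype.card β)) (dvdHarmonic d (Fintype.card β) ^ 2) := by
  rw [mul_min_of_nonneg _ _ (by positivity)]
  refine le_min (le_trans ?_ (sum_dvdCount_le d)) (le_trans ?_ (sum_dvdCount_mul_le d)) <;>
    refine Finset.sum_le_sum fun σ _ => ?_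
  · exact_mod_cast Nat.sub_le _ _
  · rcases Nat.eq_zero_or_pos (dvdCount d σ.cycleType) with h0 | h1
    · simp [h0]
    · rw [Nat.cast_sub h1, Nat.cast_one]
      have : (1 : ℝ) ≤ dvdCount d σ.cycleType := by exact_mod_cast h1
      nlinarith

/-- The number of cycles of `f` whose length is divisible by `d`. -/
def cycleDvdCount {n : ℕ} (d : ℕ) (f : Fin n → Fin n) : ℕ :=
  ((cyclesOf f).filter fun c => d ∣ c.card).card

lemma cyclesOf_card_pos {n : ℕ} {f : Fin n → Fin n} {c : Finset (Fin n)} (hc : c ∈ cyclesOf f) :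
    0 < c.card := by
  obtain ⟨x, hx, rfl⟩ := Finset.mem_image.1 hc
  exact Finset.card_pos.2 ⟨x, Finset.mem_filter.2 ⟨hx, 0, rfl⟩⟩

lemma Tmap_pos {n : ℕ} (f : Fin n → Fin n) : 0 < Tmap f := by
  refine Nat.pos_of_ne_zero fun h => ?_
  obtain ⟨c, hc, h0⟩ := Finset.lcm_eq_zero_iff.1 h
  exact (cyclesOf_card_pos hc).ne' h0

open ArithmeticFunction in
lemma log_Bmap_eq {n : ℕ} (f : Fin n → Fin n) :
    Real.log (Bmap f) = ∑ d ∈ Finset.Icc 2 n, vonMangoldt d * cycleDvdCount d f := by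
  rw [Bmap, Nat.cast_prod, Real.log_prod fun c hc => by
    exact_mod_cast (cyclesOf_card_pos hc).ne']
  have h : ∀ c ∈ cyclesOf f, Real.log (c.card : ℝ) =
      ∑ d ∈ Finset.Icc 2 n, if d ∣ c.card then vonMangoldt d else 0 := by
    intro c hc
    have hpos := cyclesOf_card_pos hc
    rw [← vonMangoldt_sum, ← Finset.sum_filter]
    symm
    refine Finset.sum_subset ?_ ?_
    · intro d hd
      exact Nat.mem_divisors.2 ⟨(Finset.mem_filter.1 hd).2, hpos.ne'⟩
    · intro d hd hd'
      have hdvd := Nat.dvd_of_mem_divisors hd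
      have hle : d ≤ n := (Nat.le_of_dvd hpos hdvd).trans (by simpa using Finset.card_le_univ c)
      have hd1 : d = 1 := by
        have := Nat.pos_of_mem_divisors hd
        by_contra hne
        exact hd' (Finset.mem_filter.2 ⟨Finset.mem_Icc.2 ⟨by lia, hle⟩, hdvd⟩)
      simp [hd1]
  rw [Finset.sum_congr rfl h, Finset.sum_comm]
  refine Finset.sum_congr rfl fun d _ => ?_
  rw [← Finset.sum_filter, Finset.sum_const, nsmul_eq_mul, mul_comm]
  rfl

open ArithmeticFunction in
lemma le_log_Tmap {n : ℕ} (f : Fin n → Fin n) :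
    ∑ d ∈ Finset.Icc 2 n, vonMangoldt d * (if 1 ≤ cycleDvdCount d f then 1 else 0) ≤
      Real.log (Tmap f) := by
  rw [← vonMangoldt_sum]
  simp only [mul_ite, mul_one, mul_zero]
  rw [← Finset.sum_filter]
  refine Finset.sum_le_sum_of_subset_of_nonneg ?_ fun _ _ _ => vonMangoldt_nonneg
  intro d hd
  obtain ⟨c, hc⟩ := Finset.card_pos.1 (Finset.mem_filter.1 hd).2
  obtain ⟨hc, hdvd⟩ := Finset.mem_filter.1 hc
  exact Nat.mem_divisors.2 ⟨hdvd.trans (Finset.dvd_lcm hc), (Tmap_pos f).ne'⟩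

open ArithmeticFunction in
lemma log_Bmap_sub_log_Tmap_le {n : ℕ} (f : Fin n → Fin n) :
    Real.log (Bmap f) - Real.log (Tmap f) ≤
      ∑ d ∈ Finset.Icc 2 n, vonMangoldt d * ((cycleDvdCount d f - 1 : ℕ) : ℝ) := by
  rw [log_Bmap_eq, sub_le_iff_le_add]
  refine le_trans (le_of_eq ?_) (add_le_add_right (le_log_Tmap f) _)
  rw [← Finset.sum_add_distrib]
  refine Finset.sum_congr rfl fun d _ => ?_
  split_ifs with h
  · rw [Nat.cast_sub h]
    push_cast
    ring
  · have : cycleDvdCount d f = 0 := by lia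
    simp [this]

lemma Tmap_dvd_Bmap {n : ℕ} (f : Fin n → Fin n) : Tmap f ∣ Bmap f :=
  Finset.lcm_dvd fun _ hc => Finset.dvd_prod_of_mem _ hc

lemma log_Tmap_le_log_Bmap {n : ℕ} (f : Fin n → Fin n) :
    Real.log (Tmap f) ≤ Real.log (Bmap f) := by
  have hB : 0 < Bmap f := Finset.prod_pos fun c hc => cyclesOf_card_pos hc
  exact Real.log_le_log (by exact_mod_cast Tmap_pos f)
    (by exact_mod_cast Nat.le_of_dvd hB (Tmap_dvd_Bmap f))

lemma iterate_coe_perm {n : ℕ} {S : Finset (Fin n)} {f : Fin n → Fin n}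
    {π : Equiv.Perm {x // x ∈ S}} (hπ : ∀ x, (π x : Fin n) = f x) (m : ℕ) (x : {x // x ∈ S}) :
    ((π ^ m) x : Fin n) = f^[m] x := by
  induction m generalizing x with
  | zero => rfl
  | succ m ih => rw [pow_succ, Equiv.Perm.mul_apply, ih, hπ, Function.iterate_succ_apply]

lemma mem_cyclicSet {n : ℕ} {f : Fin n → Fin n} {x : Fin n} :
    x ∈ cyclicSet f ↔ ∃ m, 0 < m ∧ f^[m] x = x := by
  simp [cyclicSet]

/-- A function restricts to a permutation of its cyclic nodes. -/
lemma exists_perm_cyclicSet {n : ℕ} (f : Fin n → Fin n) :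
    ∃ π : Equiv.Perm {x // x ∈ cyclicSet f}, ∀ x, (π x : Fin n) = f x := by
  have hmaps : ∀ x ∈ cyclicSet f, f x ∈ cyclicSet f := by
    intro x hx
    obtain ⟨m, hm, h⟩ := mem_cyclicSet.1 hx
    exact mem_cyclicSet.2 ⟨m, hm, by rw [← Function.iterate_succ_apply,
      Function.iterate_succ_apply', h]⟩
  let g : {x // x ∈ cyclicSet f} → {x // x ∈ cyclicSet f} := fun x => ⟨f x, hmaps x x.2⟩
  have hsurj : Function.Surjective g := by
    rintro ⟨y, hy⟩
    obtain ⟨m, hm, h⟩ := mem_cyclicSet.1 hy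
    obtain ⟨m, rfl⟩ := Nat.exists_eq_succ_of_ne_zero hm.ne'
    refine ⟨⟨f^[m] y, mem_cyclicSet.2 ⟨m + 1, hm, ?_⟩⟩, Subtype.ext ?_⟩
    · rw [← Function.iterate_add_apply, add_comm, Function.iterate_add_apply, h]
    · simp only [g, ← Function.iterate_succ_apply', h]
  exact ⟨Equiv.ofBijective g (Finite.injective_iff_bijective.1
    (Finite.injective_iff_surjective.2 hsurj)), fun x => rfl⟩

open Equiv Equiv.Perm in
lemma cycleDvdCount_le {n d : ℕ} (hd : 2 ≤ d) {S : Finset (Fin n)} {f : Fin n → Fin n}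
    (hS : cyclicSet f = S) {π : Perm {x // x ∈ S}} (hπ : ∀ x, (π x : Fin n) = f x) :
    cycleDvdCount d f ≤ dvdCount d π.cycleType := by
  rw [dvdCount_cycleType, cycleDvdCount]
  refine (Finset.card_le_card (t := (π.cycleFactorsFinset.filter
    fun c => d ∣ c.support.card).image fun c => c.support.map (Function.Embedding.subtype _))
    ?_).trans Finset.card_image_le
  intro c hc
  obtain ⟨hc, hdvd⟩ := Finset.mem_filter.1 hc
  have hpos := cyclesOf_card_pos hc
  obtain ⟨x, hx, rfl⟩ := Finset.mem_image.1 hc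
  subst hS
  set X : {x // x ∈ cyclicSet f} := ⟨x, hx⟩ with hX
  have hmem : X ∈ π.support := by
    rw [mem_support]
    intro hfix
    have hfix' : ∀ m, f^[m] x = x := fun m => by
      have h1 : (π ^ m) X = X := by
        rw [← Equiv.Perm.iterate_eq_pow]
        exact Function.iterate_fixed hfix m
      have h2 := iterate_coe_perm hπ m X
      rw [h1] at h2
      exact h2.symm
    have hle : ((cyclicSet f).filter fun y => ∃ m, f^[m] x = y).card ≤ 1 := by
      refine Finset.card_le_one.2 ?_
      intro a ha b hb
      obtain ⟨m, rfl⟩ := (Finset.mem_filter.1 ha).2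
      obtain ⟨m', rfl⟩ := (Finset.mem_filter.1 hb).2
      rw [hfix', hfix']
    have := Nat.le_of_dvd hpos hdvd
    lia
  have hsupp : (π.cycleOf X).support.map (Function.Embedding.subtype _) =
      (cyclicSet f).filter fun y => ∃ m, f^[m] x = y := by
    ext y
    simp only [Finset.mem_map, Function.Embedding.coe_subtype, Finset.mem_filter]
    constructor
    · rintro ⟨Y, hY, rfl⟩
      obtain ⟨m, hm⟩ := (mem_support_cycleOf_iff.1 hY).1.exists_nat_pow_eq
      exact ⟨Y.2, m, by rw [← hm, iterate_coe_perm hπ]⟩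
    · rintro ⟨hy, m, hm⟩
      refine ⟨⟨y, hy⟩, mem_support_cycleOf_iff.2 ⟨⟨m, Subtype.ext ?_⟩, hmem⟩, rfl⟩
      rw [zpow_natCast, iterate_coe_perm hπ, hm]
  refine Finset.mem_image.2 ⟨π.cycleOf X, Finset.mem_filter.2 ⟨?_, ?_⟩, hsupp⟩
  · exact cycleOf_mem_cycleFactorsFinset_iff.2 hmem
  · rwa [← hsupp, Finset.card_map] at hdvd

open Equiv Equiv.Perm in
lemma IsZKMap.comp_perm {n k : ℕ} {f : Fin n → Fin n} (hf : IsZKMap k f) (e : Perm (Fin n)) :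
    IsZKMap k (f ∘ e) := by
  intro y
  have : (Finset.univ.filter fun x => (f ∘ e) x = y).card =
      (Finset.univ.filter fun x => f x = y).card := by
    refine Finset.card_bij (fun x _ => e x) ?_ ?_ ?_
    · intro x hx
      simpa using hx
    · intro a _ b _ h
      exact e.injective h
    · intro b hb
      exact ⟨e.symm b, by simpa using hb, by simp⟩
  rw [this]
  exact hf y

open Equiv Equiv.Perm in
/-- Permuting the cyclic nodes among themselves does not change the set of cyclic nodes. -/
lemma cyclicSet_comp_ofSubtype {n : ℕ} {S : Finset (Fin n)} {f : Fin n → Fin n}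
    (hS : cyclicSet f = S) (τ : Perm {x // x ∈ S}) :
    cyclicSet (f ∘ ofSubtype τ) = S := by
  obtain ⟨π, hπ⟩ := exists_perm_cyclicSet f
  subst hS
  set g := f ∘ ofSubtype τ with hg
  have hπg : ∀ x, ((π * τ) x : Fin n) = g x := fun x => by
    simp [hg, hπ]
  have hstay : ∀ m, ∀ x ∈ cyclicSet f, g^[m] x ∈ cyclicSet f := fun m x hx => by
    rw [← iterate_coe_perm hπg m ⟨x, hx⟩]
    exact Subtype.property _
  ext x
  constructor
  · intro hx
    by_contra hxS
    obtain ⟨m, hm, h⟩ := mem_cyclicSet.1 hx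
    have hout : ∀ j, g^[j] x ∉ cyclicSet f := by
      intro j hj
      have hle : j ≤ m * j := Nat.le_mul_of_pos_left j hm
      have h1 := hstay (m * j - j) _ hj
      rw [← Function.iterate_add_apply, Nat.sub_add_cancel hle, Function.iterate_mul,
        Function.iterate_fixed h] at h1
      exact hxS h1
    have heq : ∀ j, g^[j] x = f^[j] x := by
      intro j
      induction j with
      | zero => rfl
      | succ j ih =>
        rw [Function.iterate_succ_apply', Function.iterate_succ_apply', ← ih, hg,
          Function.comp_apply, ofSubtype_apply_of_not_mem _ (hout j)]
    exact hxS (mem_cyclicSet.2 ⟨m, hm, by rw [← heq, h]⟩)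
  · intro hx
    refine mem_cyclicSet.2 ⟨orderOf (π * τ), orderOf_pos _, ?_⟩
    rw [← iterate_coe_perm hπg _ ⟨x, hx⟩, pow_orderOf_eq_one]
    rfl

open Equiv Equiv.Perm in
/-- Given the set `S` of cyclic nodes, the restriction of a `{0,k}`-mapping to `S` is a uniformly
random permutation. -/
lemma sum_cycleDvdCount_fiber_le {n k d : ℕ} (hd : 2 ≤ d) (S : Finset (Fin n)) :
    ∑ f ∈ zkMaps n k with cyclicSet f = S, ((cycleDvdCount d f - 1 : ℕ) : ℝ) ≤
      ((zkMaps n k).filter fun f => cyclicSet f = S).card *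
        min (dvdHarmonic d n) (dvdHarmonic d n ^ 2) := by
  set A := (zkMaps n k).filter fun f => cyclicSet f = S with hA
  set F : (Fin n → Fin n) → ℝ := fun f => ((cycleDvdCount d f - 1 : ℕ) : ℝ) with hF
  have hmem : ∀ f ∈ A, ∀ τ : Perm {x // x ∈ S}, f ∘ ofSubtype τ ∈ A := by
    intro f hf τ
    obtain ⟨h1, h2⟩ := Finset.mem_filter.1 hf
    refine Finset.mem_filter.2 ⟨?_, cyclicSet_comp_ofSubtype h2 τ⟩
    simp only [zkMaps, Finset.mem_filter, Finset.mem_univ, true_and] at h1 ⊢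
    exact h1.comp_perm _
  have hinv : ∀ τ : Perm {x // x ∈ S}, ∑ f ∈ A, F (f ∘ ofSubtype τ) = ∑ f ∈ A, F f := by
    intro τ
    refine Finset.sum_nbij' (fun f => f ∘ ofSubtype τ) (fun f => f ∘ ofSubtype τ⁻¹)
      (fun f hf => hmem f hf τ) (fun f hf => hmem f hf τ⁻¹) ?_ ?_ fun f _ => rfl
    · intro f _
      funext x
      simp
    · intro f _
      funext x
      simp
  have hsum : ∑ f ∈ A, ∑ τ : Perm {x // x ∈ S}, F (f ∘ ofSubtype τ) =
      S.card.factorial * ∑ f ∈ A, F f := by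
    rw [Finset.sum_comm, Finset.sum_congr rfl fun τ _ => hinv τ, Finset.sum_const,
      Finset.card_univ, Fintype.card_perm, Fintype.card_coe, nsmul_eq_mul]
  have hle : ∀ f ∈ A, ∑ τ : Perm {x // x ∈ S}, F (f ∘ ofSubtype τ) ≤
      S.card.factorial * min (dvdHarmonic d n) (dvdHarmonic d n ^ 2) := by
    intro f hf
    obtain ⟨h1, h2⟩ := Finset.mem_filter.1 hf
    obtain ⟨π, hπ⟩ : ∃ π : Perm {x // x ∈ S}, ∀ x, (π x : Fin n) = f x := by
      subst h2
      exact exists_perm_cyclicSet f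
    calc _ ≤ ∑ τ : Perm {x // x ∈ S}, ((dvdCount d (π * τ).cycleType - 1 : ℕ) : ℝ) := by
          refine Finset.sum_le_sum fun τ _ => ?_
          have := cycleDvdCount_le hd (cyclicSet_comp_ofSubtype h2 τ) (π := π * τ)
            fun x => by simp [hπ]
          simp only [hF]
          exact_mod_cast Nat.sub_le_sub_right this 1
      _ = ∑ τ : Perm {x // x ∈ S}, ((dvdCount d τ.cycleType - 1 : ℕ) : ℝ) :=
          Equiv.sum_comp (Equiv.mulLeft π) fun τ : Perm {x // x ∈ S} => ((dvdCount d τ.cycleType - 1 : ℕ) : ℝ)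
      _ ≤ _ := by
          refine (sum_dvdCount_sub_one_le d).trans ?_
          rw [Fintype.card_coe]
          have hm : dvdHarmonic d S.card ≤ dvdHarmonic d n :=
            dvdHarmonic_mono d (by simpa using Finset.card_le_univ S)
          have h0 := dvdHarmonic_nonneg d S.card
          gcongr
  have hfin := Finset.sum_le_sum hle
  rw [hsum, Finset.sum_const, nsmul_eq_mul, mul_left_comm] at hfin
  exact le_of_mul_le_mul_left hfin (by positivity)

lemma sum_cycleDvdCount_le {n k d : ℕ} (hd : 2 ≤ d) :
    ∑ f ∈ zkMaps n k, ((cycleDvdCount d f - 1 : ℕ) : ℝ) ≤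
      (zkMaps n k).card * min (dvdHarmonic d n) (dvdHarmonic d n ^ 2) := by
  rw [← Finset.sum_fiberwise (zkMaps n k) cyclicSet,
    Finset.card_eq_sum_card_fiberwise (f := cyclicSet) (t := Finset.univ) (by simp),
    Nat.cast_sum, Finset.sum_mul]
  exact Finset.sum_le_sum fun S _ => sum_cycleDvdCount_fiber_le hd S

open ArithmeticFunction in
lemma sum_log_Bmap_sub_log_Tmap_le (n k : ℕ) :
    ∑ f ∈ zkMaps n k, (Real.log (Bmap f) - Real.log (Tmap f)) ≤
      (zkMaps n k).card * ∑ d ∈ Finset.Icc 2 n, vonMangoldt d *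
        min ((1 + Real.log n) / d) (((1 + Real.log n) / d) ^ 2) := by
  refine (Finset.sum_le_sum fun f _ => log_Bmap_sub_log_Tmap_le f).trans ?_
  rw [Finset.sum_comm, Finset.mul_sum]
  refine Finset.sum_le_sum fun d hd => ?_
  have hd2 := (Finset.mem_Icc.1 hd).1
  rw [← Finset.mul_sum, mul_left_comm]
  refine mul_le_mul_of_nonneg_left ((sum_cycleDvdCount_le hd2).trans ?_) vonMangoldt_nonneg
  have h1 := dvdHarmonic_le (show 0 < d by lia) n
  have h0 := dvdHarmonic_nonneg d n
  gcongr

open ArithmeticFunction in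
lemma exists_sum_vonMangoldt_mul_min_le : ∃ K : ℝ, 0 ≤ K ∧ ∀ (n : ℕ) (L : ℝ), 1 ≤ L →
    ∑ d ∈ Finset.Icc 2 n, vonMangoldt d * min (L / d) ((L / d) ^ 2) ≤
      L * (4 * Real.log L * (1 + 4 * Real.log L) + K) := by
  have hs : Summable fun d : ℕ => 2 * ((d : ℝ) ^ (5 / 4 : ℝ))⁻¹ :=
    (Real.summable_nat_rpow_inv.2 (by norm_num)).mul_left 2
  refine ⟨∑' d : ℕ, 2 * ((d : ℝ) ^ (5 / 4 : ℝ))⁻¹, tsum_nonneg fun d => by positivity, ?_⟩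
  intro n L hL
  have hL0 : 0 < L := by linarith
  have hlogL : 0 ≤ Real.log L := Real.log_nonneg hL
  have hterm : ∀ d ∈ Finset.Icc 2 n, vonMangoldt d * min (L / d) ((L / d) ^ 2) ≤
      4 * L * Real.log L * (if (d : ℝ) ≤ L ^ 4 then (d : ℝ)⁻¹ else 0) +
        L * (2 * ((d : ℝ) ^ (5 / 4 : ℝ))⁻¹) := by
    intro d hd
    have hd2 : (2 : ℝ) ≤ d := by exact_mod_cast (Finset.mem_Icc.1 hd).1
    have hd0 : (0 : ℝ) < d := by linarith
    split_ifs with h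
    · have h1 : vonMangoldt d ≤ 4 * Real.log L := by
        refine vonMangoldt_le_log.trans ((Real.log_le_log hd0 h).trans ?_)
        rw [Real.log_pow]
        norm_num
      calc vonMangoldt d * min (L / d) ((L / d) ^ 2) ≤ 4 * Real.log L * (L / d) := by
            gcongr
            exact min_le_left _ _
        _ = 4 * L * Real.log L * (d : ℝ)⁻¹ := by ring
        _ ≤ _ := le_add_of_nonneg_right (by positivity)
    · have h1 : vonMangoldt d ≤ 2 * (d : ℝ) ^ (1 / 2 : ℝ) := by
        refine vonMangoldt_le_log.trans
          ((Real.log_le_rpow_div hd0.le (by norm_num : (0 : ℝ) < 1 / 2)).trans (le_of_eq ?_))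
        ring
      have h2 : L ≤ (d : ℝ) ^ (1 / 4 : ℝ) := by
        calc L = (L ^ 4) ^ (1 / 4 : ℝ) := by
              rw [← Real.rpow_natCast, ← Real.rpow_mul hL0.le]
              norm_num
          _ ≤ _ := by
              push Not at h
              gcongr
      have h3 : (d : ℝ) ^ 2 = (d : ℝ) ^ (1 / 2 : ℝ) * (d : ℝ) ^ (1 / 4 : ℝ) *
          (d : ℝ) ^ (5 / 4 : ℝ) := by
        rw [← Real.rpow_add hd0, ← Real.rpow_add hd0, ← Real.rpow_natCast]
        norm_num
      calc vonMangoldt d * min (L / d) ((L / d) ^ 2) ≤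
            2 * (d : ℝ) ^ (1 / 2 : ℝ) * (L / d) ^ 2 := by
            gcongr
            exact min_le_right _ _
        _ = 2 * (d : ℝ) ^ (1 / 2 : ℝ) * L * L / (d : ℝ) ^ 2 := by
            field_simp
        _ ≤ 2 * (d : ℝ) ^ (1 / 2 : ℝ) * L * (d : ℝ) ^ (1 / 4 : ℝ) / (d : ℝ) ^ 2 := by
            gcongr
        _ = L * (2 * ((d : ℝ) ^ (5 / 4 : ℝ))⁻¹) := by
            rw [h3]
            field_simp
        _ ≤ _ := by simp
  refine (Finset.sum_le_sum hterm).trans ?_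
  rw [Finset.sum_add_distrib, ← Finset.mul_sum, ← Finset.mul_sum]
  have hA : ∑ d ∈ Finset.Icc 2 n, (if (d : ℝ) ≤ L ^ 4 then (d : ℝ)⁻¹ else 0) ≤
      1 + 4 * Real.log L := by
    rw [← Finset.sum_filter]
    calc _ ≤ ∑ d ∈ Finset.Icc 1 ⌊L ^ 4⌋₊, (d : ℝ)⁻¹ := by
          refine Finset.sum_le_sum_of_subset_of_nonneg ?_ fun _ _ _ => by positivity
          intro d hd
          obtain ⟨hd, hle⟩ := Finset.mem_filter.1 hd
          have := (Finset.mem_Icc.1 hd).1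
          exact Finset.mem_Icc.2 ⟨by lia, Nat.le_floor hle⟩
      _ = (harmonic ⌊L ^ 4⌋₊ : ℝ) := by
          rw [harmonic_eq_sum_Icc]
          push_cast
          rfl
      _ ≤ 1 + Real.log (L ^ 4) := harmonic_floor_le_one_add_log _ (one_le_pow₀ hL)
      _ = _ := by
          rw [Real.log_pow]
          norm_num
  have hB := hs.sum_le_tsum (Finset.Icc 2 n) fun d _ => by positivity
  calc _ ≤ 4 * L * Real.log L * (1 + 4 * Real.log L) +
        L * ∑' d : ℕ, 2 * ((d : ℝ) ^ (5 / 4 : ℝ))⁻¹ := by gcongr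
    _ = _ := by ring

lemma zkProb_lt_le {n k : ℕ} {X : (Fin n → Fin n) → ℝ} {a D : ℝ} (ha : 0 < a) (hD : 0 ≤ D)
    (hX : ∀ f, 0 ≤ X f) (h : ∑ f ∈ zkMaps n k, X f ≤ (zkMaps n k).card * D) :
    zkProb n k (fun f => a < X f) ≤ D / a := by
  unfold zkProb
  refine div_le_of_le_mul₀ (by positivity) (by positivity) ?_
  rw [div_mul_eq_mul_div, le_div_iff₀ ha, mul_comm D]
  refine le_trans ?_ h
  calc _ = ∑ f ∈ zkMaps n k with a < X f, a := by rw [Finset.sum_const, nsmul_eq_mul]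
    _ ≤ ∑ f ∈ zkMaps n k with a < X f, X f :=
        Finset.sum_le_sum fun f hf => (Finset.mem_filter.1 hf).2.le
    _ ≤ _ := Finset.sum_le_sum_of_subset_of_nonneg (Finset.filter_subset _ _) fun f _ _ => hX f

/-- The expectation of `log B - log T` is `O(log n (log log n)²)`, uniformly in `k`. -/
lemma exists_sum_log_Bmap_sub_log_Tmap_le : ∃ κ : ℝ, 0 < κ ∧ ∀ᶠ n : ℕ in atTop, ∀ k : ℕ,
    ∑ f ∈ zkMaps n k, (Real.log (Bmap f) - Real.log (Tmap f)) ≤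
      (zkMaps n k).card * (κ * Real.log (Real.log n) ^ 2 * Real.log n) := by
  obtain ⟨K, hK, hsum⟩ := exists_sum_vonMangoldt_mul_min_le
  refine ⟨2 * (72 + K), by positivity, ?_⟩
  have hlog : Tendsto (fun n : ℕ => Real.log n) atTop atTop :=
    Real.tendsto_log_atTop.comp tendsto_natCast_atTop_atTop
  filter_upwards [hlog.eventually_ge_atTop 2,
    (Real.tendsto_log_atTop.comp hlog).eventually_ge_atTop 1] with n h1 h2 k
  simp only [Function.comp_apply] at h2
  refine (sum_log_Bmap_sub_log_Tmap_le n k).trans ?_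
  refine mul_le_mul_of_nonneg_left ((hsum n (1 + Real.log n) (by linarith)).trans ?_)
    (by positivity)
  set l := Real.log n
  set q := Real.log l
  have hL : 1 + l ≤ 2 * l := by linarith
  have hlogL : Real.log (1 + l) ≤ 2 * q := by
    have : Real.log (1 + l) ≤ Real.log (l ^ 2) :=
      Real.log_le_log (by linarith) (by nlinarith)
    rw [Real.log_pow] at this
    exact_mod_cast this
  have hlogL0 : 0 ≤ Real.log (1 + l) := Real.log_nonneg (by linarith)
  calc _ ≤ 2 * l * (4 * (2 * q) * (1 + 4 * (2 * q)) + K) := by gcongr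
    _ ≤ 2 * l * ((72 + K) * q ^ 2) := by
        gcongr
        nlinarith [mul_nonneg hK (by nlinarith : (0 : ℝ) ≤ q ^ 2 - 1)]
    _ = _ := by ring

lemma tendsto_log_log_sq_mul_log_div_rpow (C : ℝ) :
    Tendsto (fun x : ℝ => C * Real.log (Real.log x) ^ 2 * Real.log x /
      Real.log x ^ (3 / 2 : ℝ)) atTop (nhds 0) := by
  have h : Tendsto (fun y : ℝ => C * Real.log y ^ 2 * y / y ^ (3 / 2 : ℝ)) atTop (nhds 0) := by
    have h1 : Tendsto (fun y : ℝ => Real.log y ^ (2 : ℝ) / y ^ (1 / 2 : ℝ)) atTop (nhds 0) :=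
      (isLittleO_log_rpow_rpow_atTop 2 (by norm_num)).tendsto_div_nhds_zero
    have h2 := h1.const_mul C
    rw [mul_zero] at h2
    refine h2.congr' ?_
    filter_upwards [eventually_gt_atTop 0] with y hy
    have : y ^ (3 / 2 : ℝ) = y * y ^ (1 / 2 : ℝ) := by
      rw [← Real.rpow_one_add' hy.le (by norm_num)]
      norm_num
    rw [this, Real.rpow_two]
    field_simp
  exact h.comp Real.tendsto_log_atTop

/-- `(log B − log T)/σ_n` converges in probability to zero, with an
explicit Markov-type bound. -/
theorem stmt_13 (k n : ℕ → ℕ) (α : ℝ) (hα1 : 0 < α) (hα2 : α < 1)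
    (hk : ∀ r, 2 ≤ k r) (hn : ∀ r, n r = k r * r)
    (hko : (fun r : ℕ => (k r : ℝ)) =o[atTop] (fun r : ℕ => (n r : ℝ) ^ (1 - α)))
    (lam σn : ℕ → ℝ)
    (hlam : ∀ r, lam r = (k r : ℝ) - 1)
    (hσ : ∀ r, σn r =
      (Real.sqrt 3)⁻¹ * (Real.log (Real.sqrt ((n r : ℝ) / lam r))) ^ ((3 : ℝ) / 2)) :
    ∃ κ : ℝ, 0 < κ ∧
      (∀ ε : ℝ, 0 < ε →
        ∀ᶠ r : ℕ in atTop,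
          zkProb (n r) (k r) (fun f =>
              ε < (Real.log ((Bmap f : ℝ)) - Real.log ((Tmap f : ℝ))) / σn r) ≤
            κ * (Real.log (Real.log (n r : ℝ))) ^ 2 * Real.log (n r : ℝ) /
              (ε * σn r)) ∧
      (∀ ε : ℝ, 0 < ε →
        Tendsto (fun r => zkProb (n r) (k r) (fun f =>
            ε < (Real.log ((Bmap f : ℝ)) - Real.log ((Tmap f : ℝ))) / σn r))
          atTop (nhds 0)) := by
  have hn_top : Tendsto n atTop atTop := by
    refine tendsto_atTop_mono (fun r => ?_) tendsto_id
    rw [hn]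
    exact Nat.le_mul_of_pos_left r (by have := hk r; lia)
  have hnR : Tendsto (fun r => (n r : ℝ)) atTop atTop := tendsto_natCast_atTop_atTop.comp hn_top
  have hlog : Tendsto (fun r => Real.log (n r)) atTop atTop := Real.tendsto_log_atTop.comp hnR
  obtain ⟨κ, hκ, hsum⟩ := exists_sum_log_Bmap_sub_log_Tmap_le
  set c : ℝ := (Real.sqrt 3)⁻¹ * (α / 2) ^ ((3 : ℝ) / 2) with hc
  have hc0 : 0 < c := by positivity
  have hσ_ge : ∀ᶠ r in atTop, c * Real.log (n r) ^ ((3 : ℝ) / 2) ≤ σn r := by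
    filter_upwards [hko.bound one_pos, hnR.eventually_ge_atTop 1] with r hr h1
    have hk2 : (2 : ℝ) ≤ k r := by exact_mod_cast hk r
    have hn0 : (0 : ℝ) < n r := by linarith
    have hl0 : 0 < lam r := by rw [hlam]; linarith
    have hkn : lam r ≤ (n r : ℝ) ^ (1 - α) := by
      rw [Real.norm_of_nonneg (by positivity), Real.norm_of_nonneg (by positivity), one_mul] at hr
      rw [hlam]
      linarith
    have hge : (n r : ℝ) ^ α ≤ n r / lam r := by
      rw [le_div_iff₀ hl0]
      calc _ ≤ (n r : ℝ) ^ α * (n r : ℝ) ^ (1 - α) := by gcongr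
        _ = n r := by
            rw [← Real.rpow_add hn0]
            simp
    have hlog_ge : α / 2 * Real.log (n r) ≤ Real.log (Real.sqrt (n r / lam r)) := by
      rw [Real.log_sqrt (by positivity)]
      have := Real.log_le_log (by positivity) hge
      rw [Real.log_rpow hn0] at this
      linarith
    have hl1 := Real.log_nonneg h1
    rw [hσ, hc, mul_assoc, ← Real.mul_rpow (by positivity) hl1]
    gcongr
  have hbound : ∀ ε : ℝ, 0 < ε → ∀ᶠ r : ℕ in atTop,
      0 < σn r ∧ zkProb (n r) (k r) (fun f =>
          ε < (Real.log ((Bmap f : ℝ)) - Real.log ((Tmap f : ℝ))) / σn r) ≤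
        κ * (Real.log (Real.log (n r : ℝ))) ^ 2 * Real.log (n r : ℝ) / (ε * σn r) := by
    intro ε hε
    filter_upwards [hn_top.eventually hsum, hσ_ge, hlog.eventually_gt_atTop 0] with r h1 h2 h3
    have hσ0 : 0 < σn r := lt_of_lt_of_le (by positivity) h2
    refine ⟨hσ0, ?_⟩
    simp only [lt_div_iff₀ hσ0]
    exact zkProb_lt_le (by positivity) (by positivity)
      (fun f => sub_nonneg.2 (log_Tmap_le_log_Bmap f)) (h1 (k r))
  refine ⟨κ, hκ, fun ε hε => (hbound ε hε).mono fun r h => h.2, fun ε hε => ?_⟩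
  refine tendsto_of_tendsto_of_tendsto_of_le_of_le' tendsto_const_nhds
    ((tendsto_log_log_sq_mul_log_div_rpow (κ / (ε * c))).comp hnR)
    (Eventually.of_forall fun r => by unfold zkProb; positivity) ?_
  filter_upwards [hbound ε hε, hσ_ge, hlog.eventually_gt_atTop 0] with r ⟨hσ0, h1⟩ h2 h3
  refine h1.trans ?_
  calc _ ≤ κ * (Real.log (Real.log (n r : ℝ))) ^ 2 * Real.log (n r : ℝ) /
        (ε * (c * Real.log (n r) ^ ((3 : ℝ) / 2))) := by gcongr
    _ = _ := by
        simp only [Function.comp_apply]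
        field_simp
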